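/- For every k ≥ 1, the decomposition function g of I^k associated with the increasing reverse lexicographic order is regular: for every m ∈ G(I^k) and every s ∈ set(m), one has set(g(x_s·m)) ⊆ set(m). -/

import Mathlib

open MvPolynomial Finset

/-- A monomial in `n` variables, recorded by its exponent vector
(index `i : Fin n` corresponds to the variable `x_{i+1}` of the paper). -/
abbrev Mon (n : ℕ) := Fin n →₀ ℕ

/-- The exponent vector of the single variable `x_{j+1}` (`0`-indexed `j`). -/
noncomputable def sing (n j : ℕ) : Mon n :=
  Finsupp.onFinset Finset.univ (fun i => if (i : ℕ) = j then 1 else 0)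
    (fun a _ => Finset.mem_univ a)

/-- Total degree of a monomial. -/
def deg {n : ℕ} (m : Mon n) : ℕ := m.sum fun _ e => e

/-- `m₁ <_lex m₂` for the lexicographic order with `x_1 > x_2 > ⋯ > x_n`. -/
def lexLT {n : ℕ} (m₁ m₂ : Mon n) : Prop :=
  ∃ i : Fin n, (∀ j : Fin n, j < i → m₁ j = m₂ j) ∧ m₁ i < m₂ i

def lexLE {n : ℕ} (m₁ m₂ : Mon n) : Prop := m₁ = m₂ ∨ lexLT m₁ m₂

/-- `m₁ <_revlex m₂` : the increasing reverse lexicographic order. -/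
def revLT {n : ℕ} (m₁ m₂ : Mon n) : Prop :=
  ∃ s : Fin n, (∀ i : Fin n, s < i → m₁ i = m₂ i) ∧ m₂ s < m₁ s

def revLE {n : ℕ} (m₁ m₂ : Mon n) : Prop := m₁ = m₂ ∨ revLT m₁ m₂

/-- `min(m)`: the (0-indexed) smallest index in the support of `m`. -/
noncomputable def minIdx {n : ℕ} (m : Mon n) : ℕ := sInf {j : ℕ | ∃ h : j < n, m ⟨j, h⟩ ≠ 0}

/-- `m̄`: the part of `m` supported in the variables `x_1, …, x_l`
(0-indexed: indices `< l`). -/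
noncomputable def lowPart {n : ℕ} (l : ℕ) (m : Mon n) : Mon n :=
  m.filter fun i => (i : ℕ) < l

/-- `m̃`: the part of `m` supported in the variables `x_{l+1}, …, x_n`
(0-indexed: indices `≥ l`). -/
noncomputable def highPart {n : ℕ} (l : ℕ) (m : Mon n) : Mon n :=
  m.filter fun i => l ≤ (i : ℕ)

/-- The exponent vector of `u = x_1 · x_{l+1}^{a_{l+1}} ⋯ x_n^{a_n}`, where
`a j` (for `l ≤ j < n`, 0-indexed) is the exponent of `x_{j+1}`. -/
noncomputable def uVec (n l : ℕ) (a : ℕ → ℕ) : Mon n :=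
  sing n 0 + ∑ j ∈ Finset.Ico l n, a j • sing n j

/-- The exponent vector of `v = x_l · x_n^{d-1}`. -/
noncomputable def vVec (n l d : ℕ) : Mon n :=
  sing n (l - 1) + (d - 1) • sing n (n - 1)

/-- The lexsegment `L(u,v)`: monomials `w` of degree `d` with `u ≥_lex w ≥_lex v`. -/
def lexSeg (n l d : ℕ) (a : ℕ → ℕ) : Set (Mon n) :=
  { w | deg w = d ∧ lexLE (vVec n l d) w ∧ lexLE w (uVec n l a) }

/-- The lexsegment ideal `I = (L(u,v)) ⊆ K[x_1,…,x_n]`. -/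
noncomputable def lexIdeal (n l d : ℕ) (a : ℕ → ℕ) (K : Type*) [Field K] :
    Ideal (MvPolynomial (Fin n) K) :=
  Ideal.span ((fun w => monomial w (1 : K)) '' lexSeg n l d a)

/-- `G(J)`: the minimal monomial generators of a monomial ideal `J`, i.e.
monomials `m ∈ J` with `m / x_i ∉ J` for every `i ∈ supp m`. -/
def minGens {n : ℕ} (K : Type*) [Field K] (J : Ideal (MvPolynomial (Fin n) K)) :
    Set (Mon n) :=
  { m | monomial m (1 : K) ∈ J ∧
      ∀ i ∈ m.support, monomial (m - Finsupp.single i 1) (1 : K) ∉ J }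

/-- `J_{<revlex m}`: the ideal generated by all `z ∈ G(J)` with `z <_revlex m`. -/
noncomputable def idealBelow {n : ℕ} (K : Type*) [Field K]
    (J : Ideal (MvPolynomial (Fin n) K)) (m : Mon n) : Ideal (MvPolynomial (Fin n) K) :=
  Ideal.span ((fun z => monomial z (1 : K)) '' { z | z ∈ minGens K J ∧ revLT z m })

/-- `set(m) = {j : x_j · m ∈ J_{<revlex m}}` (0-indexed). -/
def setOfGen {n : ℕ} (K : Type*) [Field K] (J : Ideal (MvPolynomial (Fin n) K))
    (m : Mon n) : Set ℕ :=
  { j | j < n ∧ monomial (m + sing n j) (1 : K) ∈ idealBelow K J m }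

/-- The order `≺` on monomials: compare first the degree of the part supported in
`x_1,…,x_l`, then `<_lex`. -/
def precLT {n : ℕ} (l : ℕ) (m₁ m₂ : Mon n) : Prop :=
  deg (lowPart l m₁) < deg (lowPart l m₂) ∨
    (deg (lowPart l m₁) = deg (lowPart l m₂) ∧ lexLT m₁ m₂)

/-- `w = g(z)`: `w` is the `<_revlex`-smallest minimal monomial generator of `J`
dividing the monomial `z` (the value of the decomposition function). -/
def isDecompOf {n : ℕ} (K : Type*) [Field K] (J : Ideal (MvPolynomial (Fin n) K))
    (z w : Mon n) : Prop :=
  w ∈ minGens K J ∧ w ≤ z ∧ ∀ w' ∈ minGens K J, w' ≤ z → revLE w w'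

namespace Aux17

lemma sing_eq {n j : ℕ} (h : j < n) : sing n j = Finsupp.single (⟨j, h⟩ : Fin n) 1 := by
  ext i
  simp only [sing, Finsupp.onFinset_apply, Finsupp.single_apply, Fin.ext_iff]
  by_cases h' : (i : ℕ) = j <;> simp [h', eq_comm (a := j)]

lemma deg_eq {n : ℕ} (m : Mon n) : deg m = ∑ i, m i := by
  unfold deg
  exact Finsupp.sum_fintype _ _ (fun _ => rfl)

lemma deg_add {n : ℕ} (x y : Mon n) : deg (x + y) = deg x + deg y := by
  simp [deg_eq, Finset.sum_add_distrib]

lemma deg_single {n : ℕ} (i : Fin n) (r : ℕ) : deg (Finsupp.single i r : Mon n) = r := by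
  simp [deg]

/-- degree in the low variables -/
def low {n : ℕ} (l : ℕ) (m : Mon n) : ℕ := ∑ i : Fin n, if (i : ℕ) < l then m i else 0

lemma low_add {n : ℕ} (l : ℕ) (x y : Mon n) : low l (x + y) = low l x + low l y := by
  simp only [low, ← Finset.sum_add_distrib]
  refine Finset.sum_congr rfl fun i _ => ?_
  by_cases h : (i : ℕ) < l <;> simp [h]

lemma low_single {n : ℕ} (l : ℕ) (i : Fin n) :
    low l (Finsupp.single i 1 : Mon n) = if (i : ℕ) < l then 1 else 0 := by
  unfold low
  rw [Finset.sum_eq_single i]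
  · simp
  · intro b _ hb
    simp [Finsupp.single_apply, Ne.symm hb]
  · simp

lemma low_pos {n l : ℕ} {m : Mon n} (h : 1 ≤ low l m) : ∃ i : Fin n, (i : ℕ) < l ∧ 0 < m i := by
  by_contra hc
  push Not at hc
  have : low l m = 0 := by
    unfold low
    refine Finset.sum_eq_zero fun i _ => ?_
    by_cases h' : (i : ℕ) < l
    · have := hc i h'
      simp [h']; omega
    · simp [h']
  omega

lemma le_low {n l : ℕ} {m : Mon n} (i : Fin n) (h : (i : ℕ) < l) : m i ≤ low l m := by
  unfold low
  have := Finset.single_le_sum (f := fun i : Fin n => if (i : ℕ) < l then m i else 0)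
    (s := Finset.univ) (fun _ _ => Nat.zero_le _) (Finset.mem_univ i)
  simpa [h] using this

lemma lexLT_trans {n : ℕ} {x y z : Mon n} (h1 : lexLT x y) (h2 : lexLT y z) : lexLT x z := by
  obtain ⟨i, hi, hi'⟩ := h1
  obtain ⟨j, hj, hj'⟩ := h2
  rcases lt_trichotomy i j with h | h | h
  · exact ⟨i, fun t ht => (hi t ht).trans (hj t (ht.trans h)), by rw [← hj i h]; exact hi'⟩
  · subst h
    exact ⟨i, fun t ht => (hi t ht).trans (hj t ht), hi'.trans hj'⟩
  · exact ⟨j, fun t ht => (hi t (ht.trans h)).trans (hj t ht), by rw [hi j h]; exact hj'⟩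

lemma lex_total {n : ℕ} (x y : Mon n) : lexLE x y ∨ lexLT y x := by
  by_cases h : x = y
  · exact Or.inl (Or.inl h)
  have hne : (Finset.univ.filter fun i : Fin n => x i ≠ y i).Nonempty := by
    by_contra hc
    rw [Finset.not_nonempty_iff_eq_empty, Finset.filter_eq_empty_iff] at hc
    apply h
    ext i
    simpa using hc (Finset.mem_univ i)
  set i := Finset.min' _ hne with hi
  have h1 : x i ≠ y i := by
    have := Finset.min'_mem _ hne
    simpa using (Finset.mem_filter.1 this).2
  have h2 : ∀ j, j < i → x j = y j := by
    intro j hj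
    by_contra hc
    have := Finset.min'_le (Finset.univ.filter fun i : Fin n => x i ≠ y i) j (by simp [hc])
    exact absurd hj (not_lt.2 this)
  rcases lt_or_gt_of_ne h1 with h3 | h3
  · exact Or.inl (Or.inr ⟨i, h2, h3⟩)
  · exact Or.inr ⟨i, fun j hj => (h2 j hj).symm, h3⟩

lemma vVec_apply {n l d : ℕ} (i : Fin n) :
    vVec n l d i = (if (i : ℕ) = l - 1 then 1 else 0) + (if (i : ℕ) = n - 1 then d - 1 else 0) := by
  simp [vVec, sing]

lemma deg_vVec {n l d : ℕ} (hd : 2 ≤ d) (hl2 : 2 ≤ l) (hln : l ≤ n - 1) :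
    deg (vVec n l d) = d := by
  unfold vVec
  rw [sing_eq (show l - 1 < n by omega), sing_eq (show n - 1 < n by omega), deg_add, deg_single]
  rw [Finsupp.smul_single, deg_single]
  simp; omega

lemma mem_lexSeg {n l d : ℕ} {a : ℕ → ℕ} (hd : 2 ≤ d) (hl2 : 2 ≤ l) (hln : l ≤ n - 1)
    (w : Mon n) : w ∈ lexSeg n l d a ↔ deg w = d ∧ 1 ≤ low l w ∧ lexLE w (uVec n l a) := by
  unfold lexSeg
  simp only [Set.mem_setOf_eq]
  refine and_congr_right fun hw => and_congr_left fun _ => ?_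
  have hq : l - 1 < n := by omega
  constructor
  · rintro (h | ⟨i, hi, hi'⟩)
    · have := le_low (l := l) (m := w) ⟨l - 1, hq⟩ (by simp; omega)
      rw [← h, vVec_apply] at this
      rw [← h]
      simp at this; omega
    · by_cases hil : (i : ℕ) < l
      · have := le_low (m := w) i hil
        omega
      · have h1 := le_low (l := l) (m := w) ⟨l - 1, hq⟩ (by simp; omega)
        rw [← hi ⟨l - 1, hq⟩ (by rw [Fin.lt_def]; simp; omega), vVec_apply] at h1
        simp at h1; omega
  · intro h
    rcases lex_total (vVec n l d) w with h1 | ⟨i, hi, hi'⟩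
    · exact h1
    exfalso
    have hvi := vVec_apply (l := l) (d := d) i
    by_cases h1 : (i : ℕ) = l - 1
    · obtain ⟨t, ht, ht'⟩ := low_pos h
      have hvt := vVec_apply (l := l) (d := d) t
      rw [if_neg (show ¬ (i : ℕ) = n - 1 by omega)] at hvi
      rw [if_neg (show ¬ (t : ℕ) = n - 1 by omega)] at hvt
      by_cases h2 : t < i
      · rw [hi t h2, hvt, if_neg (by rw [Fin.lt_def] at h2; omega)] at ht'
        simp at ht'
      · have : t = i := by
          rw [Fin.lt_def] at h2; apply Fin.ext; omega
        subst this
        rw [if_pos h1] at hvi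
        omega
    · by_cases h2 : (i : ℕ) = n - 1
      · have hlt : deg w < deg (vVec n l d) := by
          rw [deg_eq, deg_eq]
          refine Finset.sum_lt_sum (fun t _ => ?_) ⟨i, Finset.mem_univ _, hi'⟩
          by_cases h3 : t < i
          · exact (hi t h3).le
          · have : t = i := by
              have := t.2
              rw [Fin.lt_def] at h3; apply Fin.ext; omega
            subst this
            exact hi'.le
        rw [deg_vVec hd hl2 hln] at hlt
        omega
      · simp [h1, h2] at hvi
        omega

/-- replacing x_i by x_j -/
lemma exists_move {n : ℕ} {m : Mon n} {i : Fin n} (j : Fin n) (h : 0 < m i) :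
    ∃ m' : Mon n, m' + Finsupp.single i 1 = m + Finsupp.single j 1 := by
  refine ⟨m - Finsupp.single i 1 + Finsupp.single j 1, ?_⟩
  have : Finsupp.single i 1 ≤ m := by
    rw [Finsupp.single_le_iff]; exact h
  rw [add_right_comm, tsub_add_cancel_of_le this]

lemma move_apply {n : ℕ} {m m' : Mon n} {i j : Fin n}
    (h : m' + Finsupp.single i 1 = m + Finsupp.single j 1) (t : Fin n) :
    m' t + (if i = t then 1 else 0) = m t + (if j = t then 1 else 0) := by
  have := DFunLike.congr_fun h t
  simpa [Finsupp.single_apply] using this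

lemma move_deg {n : ℕ} {m m' : Mon n} {i j : Fin n}
    (h : m' + Finsupp.single i 1 = m + Finsupp.single j 1) : deg m' = deg m := by
  have := congrArg deg h
  rw [deg_add, deg_add, deg_single, deg_single] at this
  omega

lemma move_low {n : ℕ} (l : ℕ) {m m' : Mon n} {i j : Fin n}
    (h : m' + Finsupp.single i 1 = m + Finsupp.single j 1) :
    low l m' + (if (i : ℕ) < l then 1 else 0) = low l m + (if (j : ℕ) < l then 1 else 0) := by
  have := congrArg (low l) h
  rwa [low_add, low_add, low_single, low_single] at this

lemma move_lex {n : ℕ} {m m' : Mon n} {i j : Fin n} (hij : i < j)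
    (h : m' + Finsupp.single i 1 = m + Finsupp.single j 1) : lexLT m' m := by
  refine ⟨i, fun t ht => ?_, ?_⟩
  · have := move_apply h t
    rwa [if_neg ht.ne', if_neg (ht.trans hij).ne', add_zero, add_zero] at this
  · have := move_apply h i
    rw [if_pos rfl, if_neg hij.ne'] at this
    omega

lemma move_rev {n : ℕ} {m m' : Mon n} {i j : Fin n} (hij : i < j)
    (h : m' + Finsupp.single i 1 = m + Finsupp.single j 1) : revLT m' m := by
  refine ⟨j, fun t ht => ?_, ?_⟩
  · have := move_apply h t
    rwa [if_neg (hij.trans ht).ne, if_neg ht.ne, add_zero, add_zero] at this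
  · have := move_apply h j
    rw [if_pos rfl, if_neg hij.ne] at this
    omega

lemma move_rev_conv {n : ℕ} {m m' : Mon n} {i j : Fin n}
    (h : m' + Finsupp.single i 1 = m + Finsupp.single j 1) (hr : revLT m' m) : i < j := by
  obtain ⟨s, hs, hs'⟩ := hr
  have h1 := move_apply h s
  have hjs : j = s := by
    by_contra hc
    rw [if_neg hc] at h1
    omega
  have his : i ≠ s := by
    intro hc
    rw [if_pos hc, if_pos hjs] at h1
    omega
  subst hjs
  by_contra hc
  have hlt : j < i := lt_of_le_of_ne (not_lt.1 hc) his.symm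
  have h2 := move_apply h i
  have h3 := hs i hlt
  rw [if_pos rfl, if_neg his.symm] at h2
  omega

lemma seg_move {n l d : ℕ} {a : ℕ → ℕ} (hd : 2 ≤ d) (hl2 : 2 ≤ l) (hln : l ≤ n - 1)
    {m m' : Mon n} {i j : Fin n} (hij : i < j)
    (h : m' + Finsupp.single i 1 = m + Finsupp.single j 1)
    (hm : m ∈ lexSeg n l d a) (hlow : 1 ≤ low l m') : m' ∈ lexSeg n l d a := by
  rw [mem_lexSeg hd hl2 hln] at hm ⊢
  refine ⟨(move_deg h).trans hm.1, hlow, Or.inr ?_⟩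
  rcases hm.2.2 with h1 | h1
  · rw [← h1]; exact move_lex hij h
  · exact lexLT_trans (move_lex hij h) h1

/-- sums of k elements of L -/
def P {n : ℕ} (L : Set (Mon n)) : ℕ → Set (Mon n)
  | 0 => {0}
  | k + 1 => {m | ∃ x ∈ P L k, ∃ y ∈ L, m = x + y}

lemma P_deg {n l d : ℕ} {a : ℕ → ℕ} (k : ℕ) :
    ∀ m ∈ P (lexSeg n l d a) k, deg m = k * d := by
  induction k with
  | zero => 
    rintro m rfl
    simp [deg]
  | succ k ih =>
    rintro m ⟨x, hx, y, hy, rfl⟩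
    rw [deg_add, ih x hx, hy.1]; ring

lemma P_low {n l d : ℕ} {a : ℕ → ℕ} (hd : 2 ≤ d) (hl2 : 2 ≤ l) (hln : l ≤ n - 1) (k : ℕ) :
    ∀ m ∈ P (lexSeg n l d a) k, k ≤ low l m := by
  induction k with
  | zero => intro m _; exact Nat.zero_le _
  | succ k ih =>
    rintro m ⟨x, hx, y, hy, rfl⟩
    rw [low_add]
    have := ih x hx
    have := ((mem_lexSeg hd hl2 hln y).1 hy).2.1
    omega

lemma P_move {n l d : ℕ} {a : ℕ → ℕ} (hd : 2 ≤ d) (hl2 : 2 ≤ l) (hln : l ≤ n - 1)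
    {i j : Fin n} (hij : i < j) (hc : (j : ℕ) < l ∨ l ≤ (i : ℕ)) (k : ℕ) :
    ∀ m ∈ P (lexSeg n l d a) k, 0 < m i → ∃ m' ∈ P (lexSeg n l d a) k,
      m' + Finsupp.single i 1 = m + Finsupp.single j 1 := by
  induction k with
  | zero =>
    rintro m rfl h
    simp at h
  | succ k ih =>
    rintro m ⟨x, hx, y, hy, rfl⟩ h
    rw [Finsupp.add_apply] at h
    by_cases hxi : 0 < x i
    · obtain ⟨x', hx', h'⟩ := ih x hx hxi
      exact ⟨x' + y, ⟨x', hx', y, hy, rfl⟩, by rw [add_right_comm, h', add_right_comm]⟩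
    · obtain ⟨y', h'⟩ := exists_move (m := y) (i := i) j (by omega)
      have h1 := ((mem_lexSeg hd hl2 hln y).1 hy).2.1
      have h2 := move_low l h'
      refine ⟨x + y', ⟨x, hx, y', seg_move hd hl2 hln hij h' hy ?_, rfl⟩, ?_⟩
      · rw [Fin.lt_def] at hij
        split_ifs at h2 <;> omega
      · rw [add_assoc, h', add_assoc]

lemma P_drop {n l d : ℕ} {a : ℕ → ℕ} (hd : 2 ≤ d) (hl2 : 2 ≤ l) (hln : l ≤ n - 1)
    {j : Fin n} (hj : l ≤ (j : ℕ)) (k : ℕ) :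
    ∀ m ∈ P (lexSeg n l d a) k, k < low l m → ∃ i : Fin n, i < j ∧
      ∃ m' ∈ P (lexSeg n l d a) k,
      m' + Finsupp.single i 1 = m + Finsupp.single j 1 := by
  induction k with
  | zero =>
    rintro m rfl h
    simp [low] at h
  | succ k ih =>
    rintro m ⟨x, hx, y, hy, rfl⟩ h
    rw [low_add] at h
    by_cases hxi : k < low l x
    · obtain ⟨i, hi, x', hx', h'⟩ := ih x hx hxi
      exact ⟨i, hi, x' + y, ⟨x', hx', y, hy, rfl⟩, by rw [add_right_comm, h', add_right_comm]⟩
    · obtain ⟨i, hi, hi'⟩ := low_pos (m := y) (l := l) (by omega)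
      obtain ⟨y', h'⟩ := exists_move (m := y) (i := i) j hi'
      have hij : i < j := by rw [Fin.lt_def]; omega
      have h2 := move_low l h'
      refine ⟨i, hij, x + y', ⟨x, hx, y', seg_move hd hl2 hln hij h' hy ?_, rfl⟩, ?_⟩
      · rw [if_pos hi, if_neg (by omega)] at h2
        omega
      · rw [add_assoc, h', add_assoc]

lemma pow_eq {n l d : ℕ} {a : ℕ → ℕ} (K : Type*) [Field K] (k : ℕ) :
    (lexIdeal n l d a K) ^ k =
      Ideal.span ((fun w => monomial w (1 : K)) '' P (lexSeg n l d a) k) := by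
  induction k with
  | zero => simp [P, Ideal.one_eq_top, Ideal.span_singleton_one, ← MvPolynomial.C_apply]
  | succ k ih =>
    rw [pow_succ, ih, lexIdeal, Ideal.span_mul_span']
    congr 1
    ext f
    simp only [Set.mem_mul, Set.mem_image, P, Set.mem_setOf_eq]
    constructor
    · rintro ⟨_, ⟨x, hx, rfl⟩, _, ⟨y, hy, rfl⟩, rfl⟩
      exact ⟨x + y, ⟨x, hx, y, hy, rfl⟩, by simp [monomial_mul]⟩
    · rintro ⟨_, ⟨x, hx, y, hy, rfl⟩, rfl⟩
      exact ⟨_, ⟨x, hx, rfl⟩, _, ⟨y, hy, rfl⟩, by simp [monomial_mul]⟩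

lemma mem_span {n : ℕ} (K : Type*) [Field K] (S : Set (Mon n)) (m : Mon n) :
    monomial m (1 : K) ∈ Ideal.span ((fun w => monomial w (1 : K)) '' S) ↔
      ∃ z ∈ S, z ≤ m := by
  rw [MvPolynomial.mem_ideal_span_monomial_image]
  classical
  simp [MvPolynomial.support_monomial]

lemma mono_deg {n : ℕ} {x y : Mon n} (h : x ≤ y) : deg x ≤ deg y := by
  rw [deg_eq, deg_eq]
  exact Finset.sum_le_sum fun i _ => h i

lemma mem_minGens {n l d : ℕ} {a : ℕ → ℕ} (K : Type*) [Field K] (k : ℕ) (m : Mon n) :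
    m ∈ minGens K ((lexIdeal n l d a K) ^ k) ↔ m ∈ P (lexSeg n l d a) k := by
  simp only [minGens, Set.mem_setOf_eq, pow_eq, mem_span]
  constructor
  · rintro ⟨⟨z, hz, hzm⟩, h⟩
    by_cases he : z = m
    · rwa [← he]
    exfalso
    have : ∃ i, z i < m i := by
      by_contra hc
      push Not at hc
      exact he (le_antisymm hzm hc)
    obtain ⟨i, hi⟩ := this
    refine h i (by simp; omega) ⟨z, hz, fun t => ?_⟩
    have := hzm t
    by_cases hit : i = t
    · subst hit; simp; omega
    · simp [Finsupp.single_apply, hit, this]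
  · intro h
    refine ⟨⟨m, h, le_rfl⟩, ?_⟩
    rintro i hi ⟨z, hz, hzm⟩
    have h1 := mono_deg hzm
    have h2 : Finsupp.single i 1 ≤ m := by
      rw [Finsupp.single_le_iff]
      exact Nat.one_le_iff_ne_zero.2 (by simpa using hi)
    have h3 := congrArg deg (tsub_add_cancel_of_le h2)
    rw [deg_add, deg_single, P_deg k m h] at h3
    rw [P_deg k z hz] at h1
    omega

lemma exists_of_le {n : ℕ} {z m : Mon n} {j : Fin n} (hdeg : deg z = deg m)
    (h : z ≤ m + Finsupp.single j 1) :
    ∃ i, z + Finsupp.single i 1 = m + Finsupp.single j 1 := by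
  have hne : ∃ i, z i < (m + Finsupp.single j 1 : Mon n) i := by
    by_contra hc
    push Not at hc
    have := congrArg deg (le_antisymm h hc)
    rw [deg_add, deg_single] at this
    omega
  obtain ⟨i, hi⟩ := hne
  refine ⟨i, ?_⟩
  have hle : z + Finsupp.single i 1 ≤ m + Finsupp.single j 1 := by
    intro t
    by_cases hit : i = t
    · subst hit
      rw [Finsupp.add_apply z, Finsupp.single_eq_same]; exact hi
    · have := h t
      rw [Finsupp.add_apply z, Finsupp.single_apply, if_neg hit]; simpa using this
  have h3 := congrArg deg (tsub_add_cancel_of_le hle)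
  rw [deg_add, deg_add, deg_add, deg_single, deg_single] at h3
  have h4 : deg (m + Finsupp.single j 1 - (z + Finsupp.single i 1)) = 0 := by omega
  refine le_antisymm hle ?_
  rw [← tsub_eq_zero_iff_le]
  rw [deg_eq, Finset.sum_eq_zero_iff] at h4
  ext t
  exact h4 t (Finset.mem_univ t)

lemma mem_set {n l d : ℕ} {a : ℕ → ℕ} (K : Type*) [Field K] (k : ℕ) (m : Mon n)
    (hm : m ∈ P (lexSeg n l d a) k) (j : ℕ) :
    j ∈ setOfGen K ((lexIdeal n l d a K) ^ k) m ↔ ∃ h : j < n, ∃ i : Fin n, i < ⟨j, h⟩ ∧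
      ∃ z ∈ P (lexSeg n l d a) k,
        z + Finsupp.single i 1 = m + Finsupp.single (⟨j, h⟩ : Fin n) 1 := by
  simp only [setOfGen, idealBelow, Set.mem_setOf_eq, mem_span, mem_minGens]
  constructor
  · rintro ⟨h, z, ⟨hz, hr⟩, hle⟩
    rw [sing_eq h] at hle
    obtain ⟨i, hi⟩ := exists_of_le ((P_deg k z hz).trans (P_deg k m hm).symm) hle
    exact ⟨h, i, move_rev_conv hi hr, z, hz, hi⟩
  · rintro ⟨h, i, hij, z, hz, he⟩
    refine ⟨h, z, ⟨hz, move_rev hij he⟩, ?_⟩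
    rw [sing_eq h, ← he]
    exact le_self_add

end Aux17

open Aux17

/-- Regularity of the decomposition function: for every `m ∈ G(I^k)` and
`s ∈ set(m)`, `set(g(x_s·m)) ⊆ set(m)`. -/
theorem stmt17 (n d l k : ℕ) (K : Type*) [Field K] (a : ℕ → ℕ)
    (hd : 2 ≤ d) (hl2 : 2 ≤ l) (hln : l ≤ n - 1)
    (hsum : ∑ j ∈ Finset.Ico l n, a j = d - 1) (hk : 1 ≤ k) :
    ∀ m ∈ minGens K ((lexIdeal n l d a K) ^ k),
      ∀ s ∈ setOfGen K ((lexIdeal n l d a K) ^ k) m,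
        ∀ w : Mon n, isDecompOf K ((lexIdeal n l d a K) ^ k) (m + sing n s) w →
          setOfGen K ((lexIdeal n l d a K) ^ k) w ⊆
            setOfGen K ((lexIdeal n l d a K) ^ k) m := by
  intro m hm s hs w hw j hj
  obtain ⟨hwG, hwle, hmin⟩ := hw
  have hmle : revLE w m := hmin m hm le_self_add
  rcases hmle with rfl | hrev
  · exact hj
  rw [mem_minGens] at hm hwG
  rw [mem_set K k w hwG] at hj
  rw [mem_set K k m hm]
  have hsn : s < n := hs.1
  rw [sing_eq hsn] at hwle
  obtain ⟨i, hi⟩ := exists_of_le ((P_deg k w hwG).trans (P_deg k m hm).symm) hwle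
  have his := move_rev_conv hi hrev
  obtain ⟨hjn, i', hij', z, hz, hze⟩ := hj
  refine ⟨hjn, ?_⟩
  generalize (⟨s, hsn⟩ : Fin n) = σ at *
  generalize (⟨j, hjn⟩ : Fin n) = τ at *
  have hmi : 0 < m i := by
    have := move_apply hi i
    rw [if_pos rfl, if_neg his.ne'] at this
    omega
  have hwi : 0 < w i' := by
    have := move_apply hze i'
    rw [if_pos rfl, if_neg hij'.ne'] at this
    omega
  have hkey : 0 < m i' ∨ i' = σ := by
    by_contra hc
    push Not at hc
    have := move_apply hi i'
    rw [if_neg (Ne.symm hc.2)] at this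
    omega
  by_cases hτ : (τ : ℕ) < l
  · rcases hkey with h | h
    · exact ⟨i', hij', P_move hd hl2 hln hij' (Or.inl hτ) k m hm h⟩
    · subst h
      exact ⟨i, his.trans hij', P_move hd hl2 hln (his.trans hij') (Or.inl hτ) k m hm hmi⟩
  · by_cases hc : k < low l m
    · exact P_drop hd hl2 hln (not_lt.1 hτ) k m hm hc
    · have hwl := P_low hd hl2 hln k w hwG
      have hzl := P_low hd hl2 hln k z hz
      have e1 := move_low l hi
      have e2 := move_low l hze
      have his' := Fin.lt_def.1 his
      rw [if_neg hτ] at e2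
      have hi'l : l ≤ (i' : ℕ) := by
        by_contra h
        rw [if_pos (by omega)] at e2
        split_ifs at e1 <;> omega
      rcases hkey with h | h
      · exact ⟨i', hij', P_move hd hl2 hln hij' (Or.inr hi'l) k m hm h⟩
      · subst h
        have hil : l ≤ (i : ℕ) := by
          by_contra h
          rw [if_pos (by omega), if_neg (by omega)] at e1
          omega
        exact ⟨i, his.trans hij', P_move hd hl2 hln (his.trans hij') (Or.inr hil) k m hm hmi⟩
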